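/- arXiv:2204.11805 — 8 statements merged into one kernel-verified Lean document; each statement's English description precedes it below -/
import Mathlib

section
/- In the Queen Bee game: (a) every P-position (x,y) with 0 < x ≤ y satisfies y = 2x; and (b) for every positive integer m there is exactly one P-position (x,y) with x ≤ y and (x,y) ≠ (0,0) such that m = x or m = y (so each natural number occurs once and only once as a coordinate of a P-position). -/
/-- A legal move of the Queen Bee from `p` to `q`: the Manhattan distance to the corner
decreases, and the move is within a column or row, diagonal, or a diagonal move that
bounces perpendicularly off a side of the board. -/
def QueenBeeMove (p q : ℕ × ℕ) : Prop :=
  q.1 + q.2 < p.1 + p.2 ∧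
    (q.1 = p.1 ∨ q.2 = p.2 ∨
      ((p.1 : ℤ) - q.1 = (p.2 : ℤ) - q.2) ∨
      (p.1 ≤ p.2 ∧ q.2 = p.2 - p.1) ∨
      (p.2 ≤ p.1 ∧ q.1 = p.1 - p.2))

/-- P-positions of the Queen Bee game, defined by well-founded recursion on `x + y`:
a position is a P-position iff every legal move from it leads to a non-P-position. -/
def QueenBeePPos (p : ℕ × ℕ) : Prop :=
  ∀ q, QueenBeeMove p q → ¬ QueenBeePPos q
termination_by p.1 + p.2
decreasing_by exact ‹QueenBeeMove p q›.1

/-- Positive integers of even 2-adic valuation. -/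
def EvenVal (n : ℕ) : Prop := 0 < n ∧ Even (padicValNat 2 n)

theorem EvenVal.not_two_mul {n : ℕ} (h : EvenVal n) : ¬ EvenVal (2 * n) := by
  have : Fact (Nat.Prime 2) := ⟨Nat.prime_two⟩
  rintro ⟨-, h'⟩
  rw [padicValNat.mul (by norm_num) h.1.ne', padicValNat_self, Nat.even_add] at h'
  exact absurd (h'.mpr h.2) (by decide)

theorem evenVal_or_exists_half {n : ℕ} (hn : 0 < n) :
    EvenVal n ∨ ∃ k, n = 2 * k ∧ EvenVal k := by
  have : Fact (Nat.Prime 2) := ⟨Nat.prime_two⟩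
  by_cases h : EvenVal n
  · exact .inl h
  have hodd : ¬ Even (padicValNat 2 n) := fun h' => h ⟨hn, h'⟩
  have hdvd : 2 ∣ n := by
    by_contra h2
    exact hodd (by simp [padicValNat.eq_zero_of_not_dvd h2])
  obtain ⟨k, rfl⟩ := hdvd
  have hk : 0 < k := by omega
  refine .inr ⟨k, rfl, hk, ?_⟩
  rw [padicValNat.mul (by norm_num) hk.ne', padicValNat_self, add_comm, Nat.even_add_one,
    not_not] at hodd
  exact hodd

/-- The closed form of the set of P-positions. -/
def QueenBeeKernel (p : ℕ × ℕ) : Prop :=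
  p = (0, 0) ∨ (p.2 = 2 * p.1 ∧ EvenVal p.1) ∨ (p.1 = 2 * p.2 ∧ EvenVal p.2)

theorem QueenBeeKernel.swap {p : ℕ × ℕ} (h : QueenBeeKernel p) : QueenBeeKernel p.swap := by
  rcases h with rfl | h | h
  · exact .inl rfl
  · exact .inr (.inr h)
  · exact .inr (.inl h)

theorem QueenBeeMove.swap {p q : ℕ × ℕ} (h : QueenBeeMove p q) :
    QueenBeeMove p.swap q.swap := by
  simp only [QueenBeeMove, Prod.fst_swap, Prod.snd_swap] at h ⊢
  omega

theorem QueenBeeKernel.not_of_move {p q : ℕ × ℕ} (hp : QueenBeeKernel p)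
    (hm : QueenBeeMove p q) : ¬ QueenBeeKernel q := by
  wlog hle : p.1 ≤ p.2 generalizing p q
  · exact fun hq => this hp.swap hm.swap (le_of_not_ge hle) hq.swap
  obtain ⟨x, y⟩ := p
  obtain ⟨u, v⟩ := q
  simp only [QueenBeeKernel, QueenBeeMove, Prod.mk.injEq] at *
  rintro (hq | ⟨hq, hv⟩ | ⟨hq, hv⟩) <;> rcases hp with hp | ⟨hp, hx⟩ | ⟨hp, hx⟩ <;>
    have h1 := hm.1 <;> try have h2 := hx.1
  all_goals try have h3 := hv.1
  all_goals try omega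
  · have : x = 2 * u ∨ u = x := by omega
    rcases this with rfl | rfl
    · exact hv.not_two_mul hx
    · omega
  · have : x = 2 * v := by omega
    subst this
    exact hv.not_two_mul hx

theorem exists_move_to_queenBeeKernel {p : ℕ × ℕ} (hp : ¬ QueenBeeKernel p) :
    ∃ q, QueenBeeMove p q ∧ QueenBeeKernel q := by
  wlog hle : p.1 ≤ p.2 generalizing p
  · obtain ⟨q, hm, hq⟩ := this (p := p.swap) (fun h => hp h.swap) (le_of_not_ge hle)
    exact ⟨q.swap, hm.swap, hq.swap⟩
  obtain ⟨x, y⟩ := p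
  simp only [QueenBeeKernel, QueenBeeMove, Prod.mk.injEq, Prod.exists] at *
  rcases Nat.eq_zero_or_pos x with rfl | hx
  · exact ⟨0, 0, by omega, by simp⟩
  rcases evenVal_or_exists_half hx with hE | ⟨k, rfl, hk⟩
  · rcases lt_trichotomy y (2 * x) with hy | hy | hy
    · obtain ⟨d, rfl⟩ := Nat.exists_eq_add_of_le hle
      rcases Nat.eq_zero_or_pos d with rfl | hd
      · exact ⟨0, 0, by omega, by simp⟩
      rcases evenVal_or_exists_half hd with hd' | ⟨k, rfl, hk⟩
      · exact ⟨d, 2 * d, by omega, .inr (.inl ⟨rfl, hd'⟩)⟩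
      · exact ⟨k, 2 * k, by omega, .inr (.inl ⟨rfl, hk⟩)⟩
    · exact absurd (.inr (.inl ⟨hy, hE⟩)) hp
    · exact ⟨x, 2 * x, by omega, .inr (.inl ⟨rfl, hE⟩)⟩
  · exact ⟨2 * k, k, by omega, .inr (.inr ⟨rfl, hk⟩)⟩

theorem queenBeePPos_iff_kernel (p : ℕ × ℕ) : QueenBeePPos p ↔ QueenBeeKernel p := by
  induction hn : p.1 + p.2 using Nat.strong_induction_on generalizing p with
  | _ n ih =>
    subst hn
    rw [QueenBeePPos]
    constructor
    · intro h
      by_contra hp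
      obtain ⟨q, hm, hq⟩ := exists_move_to_queenBeeKernel hp
      exact h q hm ((ih _ hm.1 q rfl).mpr hq)
    · intro hp q hm hq
      exact hp.not_of_move hm ((ih _ hm.1 q rfl).mp hq)

theorem queenBeePPos_and_le_iff {p : ℕ × ℕ} :
    (QueenBeePPos p ∧ p.1 ≤ p.2 ∧ p ≠ (0, 0)) ↔ p.2 = 2 * p.1 ∧ EvenVal p.1 := by
  rw [queenBeePPos_iff_kernel]
  constructor
  · rintro ⟨h | h | ⟨h, h'⟩, hle, h0⟩
    · exact absurd h h0
    · exact h
    · have := h'.1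
      omega
  · rintro h
    have := h.2.1
    refine ⟨.inr (.inl h), by omega, ?_⟩
    rintro rfl
    exact absurd this (lt_irrefl 0)

/-- (a) every P-position `(x,y)` with `0 < x ≤ y` satisfies `y = 2x`; and
(b) every positive integer occurs once and only once as a coordinate of a
nonzero P-position `(x,y)` with `x ≤ y`. -/
theorem queenBee_ppos_structure :
    (∀ x y : ℕ, QueenBeePPos (x, y) → 0 < x → x ≤ y → y = 2 * x) ∧
    (∀ m : ℕ, 0 < m →
      ∃! p : ℕ × ℕ, QueenBeePPos p ∧ p.1 ≤ p.2 ∧ p ≠ (0, 0) ∧ (m = p.1 ∨ m = p.2)) := by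
  refine ⟨fun x y h hx hle => ?_, fun m hm => ?_⟩
  · exact (queenBeePPos_and_le_iff.mp ⟨h, hle, by simp [hx.ne']⟩).1
  have key : ∀ p : ℕ × ℕ, (QueenBeePPos p ∧ p.1 ≤ p.2 ∧ p ≠ (0, 0) ∧ (m = p.1 ∨ m = p.2)) ↔
      (p.2 = 2 * p.1 ∧ EvenVal p.1) ∧ (m = p.1 ∨ m = p.2) := fun p => by
    rw [← queenBeePPos_and_le_iff]
    tauto
  simp only [key]
  rcases evenVal_or_exists_half hm with hE | ⟨k, rfl, hk⟩
  · refine ⟨(m, 2 * m), ⟨⟨rfl, hE⟩, .inl rfl⟩, ?_⟩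
    rintro ⟨u, v⟩ ⟨⟨hv, hu⟩, h | h⟩
    · simp only [Prod.mk.injEq] at *
      omega
    · exact absurd (h.trans hv ▸ hE) hu.not_two_mul
  · refine ⟨(k, 2 * k), ⟨⟨rfl, hk⟩, .inr rfl⟩, ?_⟩
    rintro ⟨u, v⟩ ⟨⟨hv, hu⟩, h | h⟩
    · exact absurd (h ▸ hu) hk.not_two_mul
    · simp only [Prod.mk.injEq] at *
      omega
end

section
/- For every n ∈ ℕ and every position (x,y) with x ≤ y and (x,y) ∉ {(a_i,b_i) : i ≤ n}, there exists a legal move in the 2-Queen Dee game from (x,y) to some position in {(a_i,b_i) : i ≤ n} ∪ {(b_i,a_i) : i ≤ n} if and only if {x, y} ∩ ({a_i : i ≤ n} ∪ {b_i : i ≤ n}) ≠ ∅, or {y−x−1, y−x, y−x+1} ∩ ({b_i − a_i : i ≤ n} ∪ {b_i + a_i : i ≤ n}) ≠ ∅ (intersections computed in ℤ). -/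
/-- A legal move of the 2-Queen Dee from `p` to `q`: the Manhattan distance decreases,
and the move is within a column or row, a diagonal move possibly preceded by a single
one-step sidestep, or such a diagonal move reflecting off a side of the board and
continuing anti-diagonally. -/
def QDeeMove (p q : ℕ × ℕ) : Prop :=
  q.1 + q.2 < p.1 + p.2 ∧
    (q.1 = p.1 ∨ q.2 = p.2 ∨
      |((q.2 : ℤ) - q.1) - ((p.2 : ℤ) - p.1)| ≤ 1 ∨
      |((q.1 : ℤ) + q.2) - abs ((p.2 : ℤ) - p.1)| ≤ 1)

/-- `mex S` : the least natural number not in `S`. -/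
noncomputable def mex (S : Set ℕ) : ℕ := sInf {m : ℕ | m ∉ S}

/-- `mex₂ S` : the least positive even integer not in `S`. -/
noncomputable def mex₂ (S : Set ℕ) : ℕ := sInf {m : ℕ | 0 < m ∧ Even m ∧ m ∉ S}

/-- The sequence of pairs `(aₙ, bₙ)`: `(a₀,b₀) = (0,0)`,
`a_{n+1} = mex({aᵢ : i ≤ n} ∪ {bᵢ : i ≤ n})` and
`b_{n+1} = a_{n+1} + mex₂({bᵢ − aᵢ : i ≤ n} ∪ {bᵢ + aᵢ : i ≤ n})`. -/
noncomputable def qdee : ℕ → ℕ × ℕ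
  | 0 => (0, 0)
  | n + 1 =>
      let A : ℕ := mex ({m | ∃ i, ∃ _ : i ≤ n, m = (qdee i).1} ∪
        {m | ∃ i, ∃ _ : i ≤ n, m = (qdee i).2})
      let D : ℕ := mex₂ ({m | ∃ i, ∃ _ : i ≤ n, m = (qdee i).2 - (qdee i).1} ∪
        {m | ∃ i, ∃ _ : i ≤ n, m = (qdee i).2 + (qdee i).1})
      (A, A + D)
termination_by n => n
decreasing_by all_goals omega

theorem mex_notMem {S : Set ℕ} (hS : S.Finite) : mex S ∉ S :=
  Nat.sInf_mem (s := {m : ℕ | m ∉ S}) hS.infinite_compl.nonempty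

theorem mem_of_lt_mex {S : Set ℕ} {m : ℕ} (h : m < mex S) : m ∈ S := by
  by_contra hm
  exact Nat.notMem_of_lt_sInf h hm

theorem mem_of_lt_mex₂ {S : Set ℕ} {m : ℕ} (hpos : 0 < m) (heven : Even m)
    (h : m < mex₂ S) : m ∈ S := by
  by_contra hm
  exact Nat.notMem_of_lt_sInf h ⟨hpos, heven, hm⟩

theorem qdee_zero : qdee 0 = (0, 0) := by
  rw [qdee]

theorem qdee_fst_le_snd (i : ℕ) : (qdee i).1 ≤ (qdee i).2 := by
  cases i with
  | zero => rw [qdee]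
  | succ n =>
    rw [qdee]
    exact Nat.le_add_right _ _

theorem exists_lt_of_lt_qdee_fst {i x : ℕ} (h : x < (qdee i).1) :
    ∃ j < i, x = (qdee j).1 ∨ x = (qdee j).2 := by
  cases i with
  | zero => simp [qdee_zero] at h
  | succ n =>
    rw [qdee] at h
    rcases mem_of_lt_mex h with ⟨j, hj, hx⟩ | ⟨j, hj, hx⟩
    · exact ⟨j, by omega, Or.inl hx⟩
    · exact ⟨j, by omega, Or.inr hx⟩

theorem qdee_fst_ne {i j : ℕ} (h : j < i) :
    (qdee i).1 ≠ (qdee j).1 ∧ (qdee i).1 ≠ (qdee j).2 := by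
  cases i with
  | zero => omega
  | succ n =>
    have hfin (f : ℕ → ℕ) : {m | ∃ i, ∃ _ : i ≤ n, m = f i}.Finite :=
      ((Set.finite_Iic n).image f).subset (by rintro m ⟨i, hi, rfl⟩; exact ⟨i, hi, rfl⟩)
    have key := mex_notMem ((hfin fun i => (qdee i).1).union (hfin fun i => (qdee i).2))
    rw [qdee]
    exact ⟨fun e => key (Or.inl ⟨j, by omega, e⟩), fun e => key (Or.inr ⟨j, by omega, e⟩)⟩

theorem qdee_fst_strictMono : StrictMono fun i => (qdee i).1 := by
  intro j i h
  by_contra! hle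
  rcases hle.lt_or_eq with hlt | heq
  · obtain ⟨k, hk, hx⟩ := exists_lt_of_lt_qdee_fst hlt
    have := qdee_fst_ne (hk.trans h)
    tauto
  · exact (qdee_fst_ne h).1 heq

theorem exists_lt_of_even_lt_qdee_sub {i e : ℕ} (hpos : 0 < e) (heven : Even e)
    (h : (qdee i).1 + e < (qdee i).2) :
    ∃ j < i, (qdee j).1 + e = (qdee j).2 ∨ e = (qdee j).2 + (qdee j).1 := by
  cases i with
  | zero => simp [qdee_zero] at h
  | succ n =>
    rw [qdee] at h
    rcases mem_of_lt_mex₂ hpos heven (Nat.add_lt_add_iff_left.mp h) with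
      ⟨j, hj, hx⟩ | ⟨j, hj, hx⟩
    · exact ⟨j, by omega, Or.inl (by omega)⟩
    · exact ⟨j, by omega, Or.inr hx⟩

/-- Between the diagonal and the `i`-th pair, every position of the column `x = aᵢ` has a
move to an earlier pair. -/
theorem exists_qdeeMove_of_lt_qdee_snd {i y : ℕ} (hxy : (qdee i).1 ≤ y)
    (hy : y < (qdee i).2) : ∃ j ≤ i, QDeeMove ((qdee i).1, y) (qdee j) := by
  have hi : 0 < i := by
    rcases Nat.eq_zero_or_pos i with rfl | h
    · simp [qdee_zero] at hy
    · exact h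
  have hx : 0 < (qdee i).1 := by simpa [qdee_zero] using qdee_fst_strictMono hi
  by_cases hd : y ≤ (qdee i).1 + 1
  · exact ⟨0, hi.le, by simp only [QDeeMove, qdee_zero, abs_le]; omega⟩
  · obtain ⟨e, he, heven, h1, h2⟩ : ∃ e, 0 < e ∧ Even e ∧ (qdee i).1 + e ≤ y ∧
        y ≤ (qdee i).1 + e + 1 :=
      ⟨2 * ((y - (qdee i).1) / 2), by omega, even_two_mul _, by omega, by omega⟩
    obtain ⟨j, hj, hje⟩ := exists_lt_of_even_lt_qdee_sub he heven (h1.trans_lt hy)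
    have := qdee_fst_strictMono hj
    exact ⟨j, hj.le, by simp only [QDeeMove, abs_le]; grind⟩

theorem qdeeMove_self_qdee_zero {n x : ℕ} (hnot : ∀ i ≤ n, (x, x) ≠ qdee i) :
    QDeeMove (x, x) (qdee 0) := by
  have h := hnot 0 n.zero_le
  rw [qdee_zero] at h ⊢
  have : x ≠ 0 := by rintro rfl; exact h rfl
  simp only [QDeeMove, abs_le]
  omega

theorem exists_qdeeMove_of_fst_mem {n x y : ℕ} (hxy : x ≤ y)
    (hnot : ∀ i ≤ n, (x, y) ≠ qdee i)
    (h : ∃ i ≤ n, x = (qdee i).1 ∨ x = (qdee i).2) :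
    ∃ i ≤ n, QDeeMove (x, y) (qdee i) ∨ QDeeMove (x, y) ((qdee i).2, (qdee i).1) := by
  obtain ⟨i, hi, rfl | rfl⟩ := h
  · rcases lt_trichotomy y (qdee i).2 with hlt | rfl | hgt
    · obtain ⟨j, hj, hm⟩ := exists_qdeeMove_of_lt_qdee_snd hxy hlt
      exact ⟨j, hj.trans hi, Or.inl hm⟩
    · exact absurd rfl (hnot i hi)
    · exact ⟨i, hi, Or.inl ⟨by simpa using hgt, Or.inl rfl⟩⟩
  · have hle := qdee_fst_le_snd i
    rcases (hle.trans hxy).lt_or_eq with hlt | heq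
    · exact ⟨i, hi, Or.inr ⟨by simp only; omega, Or.inl rfl⟩⟩
    · obtain rfl : (qdee i).2 = y := by omega
      exact ⟨0, n.zero_le, Or.inl (qdeeMove_self_qdee_zero hnot)⟩

/-- For every `n` and every position `(x,y)` with `x ≤ y` not among the first `n+1`
P-positions, there is a legal 2-Queen Dee move from `(x,y)` to some `(aᵢ,bᵢ)` or
`(bᵢ,aᵢ)` with `i ≤ n` iff `{x,y}` meets `{aᵢ : i ≤ n} ∪ {bᵢ : i ≤ n}`, or
`{y−x−1, y−x, y−x+1}` meets `{bᵢ − aᵢ : i ≤ n} ∪ {bᵢ + aᵢ : i ≤ n}` (in `ℤ`). -/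
theorem qdee_move_to_ppositions_iff (n x y : ℕ) (hxy : x ≤ y)
    (hnot : ∀ i ≤ n, (x, y) ≠ qdee i) :
    (∃ i ≤ n, QDeeMove (x, y) (qdee i) ∨ QDeeMove (x, y) ((qdee i).2, (qdee i).1)) ↔
      ((∃ i ≤ n, x = (qdee i).1 ∨ x = (qdee i).2 ∨ y = (qdee i).1 ∨ y = (qdee i).2) ∨
       (∃ i ≤ n, ∃ d : ℤ,
          (d = (y : ℤ) - x - 1 ∨ d = (y : ℤ) - x ∨ d = (y : ℤ) - x + 1) ∧
          (d = ((qdee i).2 : ℤ) - (qdee i).1 ∨ d = ((qdee i).2 : ℤ) + (qdee i).1))) := by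
  have hcol := exists_qdeeMove_of_fst_mem hxy hnot
  have hlow {i : ℕ} (hi : i ≤ n) (hx : x < (qdee i).1) :
      ∃ j ≤ n, x = (qdee j).1 ∨ x = (qdee j).2 := by
    obtain ⟨j, hj, h⟩ := exists_lt_of_lt_qdee_fst hx
    exact ⟨j, hj.le.trans hi, h⟩
  constructor
  · rintro ⟨i, hi, hm⟩
    have hle := qdee_fst_le_snd i
    simp only [QDeeMove] at hm
    by_cases h : x = (qdee i).1 ∨ x = (qdee i).2 ∨ y = (qdee i).1 ∨ y = (qdee i).2
    · exact Or.inl ⟨i, hi, h⟩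
    · refine Or.inr ⟨i, hi, ?_⟩
      have : |((qdee i).2 : ℤ) - (qdee i).1 - (y - x)| ≤ 1 ∨
          |((qdee i).2 : ℤ) + (qdee i).1 - (y - x)| ≤ 1 := by
        rw [abs_of_nonneg (show (0 : ℤ) ≤ (y : ℤ) - x by omega)] at hm
        simp only [abs_le] at hm ⊢
        omega
      rcases this with h | h
      · exact ⟨_, by rw [abs_le] at h; omega, Or.inl rfl⟩
      · exact ⟨_, by rw [abs_le] at h; omega, Or.inr rfl⟩
  · rintro (⟨i, hi, h⟩ | ⟨i, hi, d, hd, h⟩)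
    · rcases h with h | h | h | h
      · exact hcol ⟨i, hi, Or.inl h⟩
      · exact hcol ⟨i, hi, Or.inr h⟩
      · rcases hxy.lt_or_eq with hlt | heq
        · exact hcol (hlow hi (h ▸ hlt))
        · exact hcol ⟨i, hi, Or.inl (heq.trans h)⟩
      · rcases lt_trichotomy x (qdee i).1 with hlt | heq | hgt
        · exact hcol (hlow hi hlt)
        · exact hcol ⟨i, hi, Or.inl heq⟩
        · exact ⟨i, hi, Or.inl ⟨by simp only; omega, Or.inr (Or.inl h.symm)⟩⟩
    · rcases Nat.eq_zero_or_pos x with rfl | hx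
      · exact hcol ⟨0, n.zero_le, Or.inl (by rw [qdee_zero])⟩
      rcases lt_trichotomy x (qdee i).1 with hlt | heq | hgt
      · exact hcol (hlow hi hlt)
      · exact hcol ⟨i, hi, Or.inl heq⟩
      · refine ⟨i, hi, Or.inl ?_⟩
        simp only [QDeeMove]
        rw [abs_of_nonneg (show (0 : ℤ) ≤ (y : ℤ) - x by omega)]
        simp only [abs_le]
        omega
end

section
/- For all n ∈ ℕ the following four equalities hold: a_n = β_n − α_n, b_n = β_n + α_n, b_n − a_n = 2·α_n, and b_n + a_n = 2·β_n. (That is, the coordinates of the P-positions of the 2-Queen Dee are the differences and sums of the coordinates of the P-positions of the Queen Dee, and conversely.) -/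
/-- The P-positions `(αₙ, βₙ)` of Corner the Queen Dee: `(α₀,β₀) = (0,0)`,
`α_{n+1} = mex({αᵢ : i ≤ n} ∪ {βᵢ : i ≤ n})` and
`β_{n+1} = α_{n+1} + mex({βᵢ − αᵢ : i ≤ n} ∪ {βᵢ + αᵢ : i ≤ n})`. -/
noncomputable def qdee1 : ℕ → ℕ × ℕ
  | 0 => (0, 0)
  | n + 1 =>
      let A : ℕ := mex ({m | ∃ i, ∃ _ : i ≤ n, m = (qdee1 i).1} ∪
        {m | ∃ i, ∃ _ : i ≤ n, m = (qdee1 i).2})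
      let D : ℕ := mex ({m | ∃ i, ∃ _ : i ≤ n, m = (qdee1 i).2 - (qdee1 i).1} ∪
        {m | ∃ i, ∃ _ : i ≤ n, m = (qdee1 i).2 + (qdee1 i).1})
      (A, A + D)
termination_by n => n
decreasing_by all_goals omega

theorem mex₂_eq_two_mul_mex {S T : Set ℕ} (h0 : 0 ∈ S) (h : ∀ m, 2 * m ∈ T ↔ m ∈ S) :
    mex₂ T = 2 * mex S := by
  have himage : {m : ℕ | 0 < m ∧ Even m ∧ m ∉ T} = (2 * ·) '' {m : ℕ | m ∉ S} := by
    ext m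
    constructor
    · rintro ⟨-, he, hm⟩
      obtain ⟨k, rfl⟩ := he.two_dvd
      exact ⟨k, fun hk => hm ((h k).2 hk), rfl⟩
    · rintro ⟨k, hk, rfl⟩
      have hk0 : k ≠ 0 := by
        rintro rfl
        exact hk h0
      exact ⟨by dsimp only; omega, even_two_mul k, fun hm => hk ((h k).1 hm)⟩
  unfold mex₂ mex
  rw [himage]
  rcases Set.eq_empty_or_nonempty {m : ℕ | m ∉ S} with hS | hS
  · simp [hS]
  · have hmono : Monotone (fun m : ℕ => 2 * m) := fun _ _ hab => Nat.mul_le_mul_left 2 hab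
    exact (hmono.map_csInf hS).symm

theorem qdee1_fst_le_snd (n : ℕ) : (qdee1 n).1 ≤ (qdee1 n).2 := by
  cases n with
  | zero => simp [qdee1]
  | succ n =>
    rw [qdee1]
    exact Nat.le_add_right _ _

theorem qdee_eq_sub_add (n : ℕ) :
    qdee n = ((qdee1 n).2 - (qdee1 n).1, (qdee1 n).2 + (qdee1 n).1) := by
  induction n using Nat.strong_induction_on with
  | _ n ih =>
    cases n with
    | zero => simp [qdee, qdee1]
    | succ n =>
      have hA : mex ({m | ∃ i, ∃ _ : i ≤ n, m = (qdee i).1} ∪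
            {m | ∃ i, ∃ _ : i ≤ n, m = (qdee i).2}) =
          mex ({m | ∃ i, ∃ _ : i ≤ n, m = (qdee1 i).2 - (qdee1 i).1} ∪
            {m | ∃ i, ∃ _ : i ≤ n, m = (qdee1 i).2 + (qdee1 i).1}) := by
        congr 2 <;> ext m <;> refine exists_congr fun i => exists_congr fun hi => ?_ <;>
          rw [ih i (Nat.lt_succ_of_le hi)]
      have hD : mex₂ ({m | ∃ i, ∃ _ : i ≤ n, m = (qdee i).2 - (qdee i).1} ∪
            {m | ∃ i, ∃ _ : i ≤ n, m = (qdee i).2 + (qdee i).1}) =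
          2 * mex ({m | ∃ i, ∃ _ : i ≤ n, m = (qdee1 i).1} ∪
            {m | ∃ i, ∃ _ : i ≤ n, m = (qdee1 i).2}) := by
        refine mex₂_eq_two_mul_mex (Or.inl ⟨0, Nat.zero_le n, by simp [qdee1]⟩) fun m => ?_
        refine or_congr ?_ ?_ <;> refine exists_congr fun i => exists_congr fun hi => ?_ <;>
          rw [ih i (Nat.lt_succ_of_le hi)] <;>
          have hle := qdee1_fst_le_snd i <;> dsimp only <;> omega
      rw [qdee, qdee1]
      dsimp only
      rw [hA, hD]
      ext <;> dsimp only <;> omega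

/-- For all `n`: `aₙ = βₙ − αₙ`, `bₙ = βₙ + αₙ`, `bₙ − aₙ = 2αₙ` and `bₙ + aₙ = 2βₙ`. -/
theorem qdee_eq_qdee1 (n : ℕ) :
    (qdee n).1 = (qdee1 n).2 - (qdee1 n).1 ∧
    (qdee n).2 = (qdee1 n).2 + (qdee1 n).1 ∧
    (qdee n).2 - (qdee n).1 = 2 * (qdee1 n).1 ∧
    (qdee n).2 + (qdee n).1 = 2 * (qdee1 n).2 := by
  have hle := qdee1_fst_le_snd n
  rw [qdee_eq_sub_add n]
  dsimp only
  omega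
end

section
/- For every n ≥ 1, a_n equals the position of the n-th occurrence of the letter a in t_b, and b_n equals the position of the n-th occurrence of the letter c in t_b. (That is, the P-positions of Corner the 2-Queen Dee are coded by the Tribonacci word with all b's deleted.) -/
inductive ABC : Type | A | B | C
  deriving DecidableEq

/-- The Tribonacci substitution `τ(a) = ab`, `τ(b) = ac`, `τ(c) = a`. -/
def τ : ABC → List ABC
  | .A => [.A, .B]
  | .B => [.A, .C]
  | .C => [.A]

/-- The `n`-th iterate `τⁿ(a)`. -/
def tribIter (n : ℕ) : List ABC := (fun l => l.flatMap τ)^[n] [ABC.A]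

/-- The Tribonacci word `t = abacabaabacab⋯` (0-indexed), the unique fixed point of `τ`
beginning with `a`; since `τⁿ⁺¹(a)` has length greater than `n` and each `τⁿ(a)` is a
prefix of `τⁿ⁺¹(a)`, its `n`-th letter is the `n`-th letter of `τⁿ⁺¹(a)`. -/
def trib (n : ℕ) : ABC := (tribIter (n + 1)).getD n ABC.A

/-- The infinite word (0-indexed) obtained from the Tribonacci word by deleting all
occurrences of the letter `x`. -/
noncomputable def tribDel (x : ABC) (n : ℕ) : ABC :=
  trib (Nat.nth (fun i => trib i ≠ x) n)

/-- The position (1-indexed) of the `n`-th occurrence (`n ≥ 1`) of the letter `x`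
in the infinite word `w` (with `w` given by its letters at 0-indexed places). -/
noncomputable def occ (w : ℕ → ABC) (x : ABC) (n : ℕ) : ℕ :=
  Nat.nth (fun i => w i = x) (n - 1) + 1

/-- The number of occurrences of `x` among the first `m` letters of the Tribonacci word. -/
abbrev tribCount (x : ABC) (m : ℕ) : ℕ := Nat.count (fun i => trib i = x) m

/-- The prefix of length `m` of the Tribonacci word. -/
def tribPrefix (m : ℕ) : List ABC := (List.range m).map trib

/-- The length of the image under `τ` of the prefix of length `m` of the Tribonacci word. -/
def tribLen (m : ℕ) : ℕ := m + tribCount .A m + tribCount .B m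

theorem tribIter_succ (n : ℕ) : tribIter (n + 1) = (tribIter n).flatMap τ := by
  simp only [tribIter, Function.iterate_succ_apply']

theorem List.IsPrefix.flatMap_τ {l l' : List ABC} (h : l <+: l') : l.flatMap τ <+: l'.flatMap τ := by
  obtain ⟨s, rfl⟩ := h
  simp

theorem tribIter_prefix_succ (n : ℕ) : tribIter n <+: tribIter (n + 1) := by
  induction n with
  | zero => exact ⟨[.B], rfl⟩
  | succ n ih =>
    rw [tribIter_succ n, tribIter_succ (n + 1)]
    exact ih.flatMap_τ

theorem tribIter_prefix {m n : ℕ} (h : m ≤ n) : tribIter m <+: tribIter n := by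
  induction n, h using Nat.le_induction with
  | base => exact List.prefix_rfl
  | succ n _ ih => exact ih.trans (tribIter_prefix_succ n)

theorem length_le_length_flatMap_τ (l : List ABC) : l.length ≤ (l.flatMap τ).length := by
  induction l with
  | nil => simp
  | cons x l ih =>
    have hx : 0 < (τ x).length := by cases x <;> simp [τ]
    rw [List.flatMap_cons, List.length_append, List.length_cons]
    omega

theorem lt_length_tribIter (n : ℕ) : n < (tribIter n).length := by
  induction n with
  | zero => simp [tribIter]
  | succ n ih =>
    obtain ⟨s, hs⟩ := tribIter_prefix (Nat.zero_le n)
    have hA : tribIter n = .A :: s := hs.symm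
    have := length_le_length_flatMap_τ s
    rw [tribIter_succ, hA]
    rw [hA] at ih
    simp only [List.flatMap_cons, List.length_append, List.length_cons, τ] at ih ⊢
    omega

theorem getElem_tribIter {n i : ℕ} (h : i < (tribIter n).length) : (tribIter n)[i] = trib i := by
  have hi : i < (tribIter (i + 1)).length := (Nat.lt_succ_self i).trans (lt_length_tribIter _)
  have ht : trib i = (tribIter (i + 1))[i] := by simp [trib, hi]
  rw [ht]
  rcases le_total n (i + 1) with hn | hn
  · exact (tribIter_prefix hn).getElem h
  · exact ((tribIter_prefix hn).getElem hi).symm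

theorem tribIter_eq_tribPrefix (n : ℕ) : tribIter n = tribPrefix (tribIter n).length := by
  apply List.ext_getElem
  · simp [tribPrefix]
  · intro i h _
    simp [tribPrefix, getElem_tribIter h]

theorem length_tribPrefix (m : ℕ) : (tribPrefix m).length = m := by simp [tribPrefix]

theorem tribPrefix_succ (m : ℕ) : tribPrefix (m + 1) = tribPrefix m ++ [trib m] := by
  simp [tribPrefix, List.range_succ]

theorem tribPrefix_prefix {m n : ℕ} (h : m ≤ n) : tribPrefix m <+: tribPrefix n := by
  induction n, h using Nat.le_induction with
  | base => exact List.prefix_rfl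
  | succ n _ ih => exact ih.trans ⟨[trib n], (tribPrefix_succ n).symm⟩

theorem tribLen_succ (m : ℕ) : tribLen (m + 1) = tribLen m + (τ (trib m)).length := by
  simp only [tribLen, tribCount, Nat.count_succ]
  cases trib m <;> simp [τ] <;> omega

theorem length_flatMap_tribPrefix (m : ℕ) : ((tribPrefix m).flatMap τ).length = tribLen m := by
  induction m with
  | zero => simp [tribPrefix, tribLen]
  | succ m ih =>
    rw [tribPrefix_succ, List.flatMap_append, List.length_append, ih, tribLen_succ]
    simp

theorem flatMap_tribPrefix (m : ℕ) : (tribPrefix m).flatMap τ = tribPrefix (tribLen m) := by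
  have h : (tribPrefix m).flatMap τ <+: tribPrefix (tribIter (m + 1)).length := by
    rw [← tribIter_eq_tribPrefix, tribIter_succ, tribIter_eq_tribPrefix m]
    exact (tribPrefix_prefix (lt_length_tribIter m).le).flatMap_τ
  have hle : tribLen m ≤ (tribIter (m + 1)).length := by
    simpa only [length_flatMap_tribPrefix, length_tribPrefix] using h.length_le
  exact (List.prefix_of_prefix_length_le h (tribPrefix_prefix hle)
    (by rw [length_flatMap_tribPrefix, length_tribPrefix])).eq_of_length
      (by rw [length_flatMap_tribPrefix, length_tribPrefix])

theorem tribPrefix_tribLen_succ (m : ℕ) :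
    tribPrefix (tribLen (m + 1)) = tribPrefix (tribLen m) ++ τ (trib m) := by
  simp [← flatMap_tribPrefix, tribPrefix_succ]

theorem trib_tribLen_add {m i : ℕ} (h : i < (τ (trib m)).length) :
    trib (tribLen m + i) = (τ (trib m))[i] := by
  have hm := congrArg (fun l => l[tribLen m + i]?) (tribPrefix_tribLen_succ m)
  have hlen := congrArg List.length (tribPrefix_tribLen_succ m)
  simp only [tribPrefix, List.length_append, List.length_map, List.length_range] at hlen
  have hlt : tribLen m + i < tribLen (m + 1) := by omega
  simpa [tribPrefix, hlt, h, List.getElem?_append] using hm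

theorem trib_tribLen (m : ℕ) : trib (tribLen m) = .A := by
  have h : 0 < (τ (trib m)).length := by cases trib m <;> simp [τ]
  have := trib_tribLen_add h
  cases hm : trib m <;> simpa [hm, τ] using this

theorem trib_tribLen_of_A {m : ℕ} (h : trib m = .A) : trib (tribLen m + 1) = .B := by
  have := trib_tribLen_add (m := m) (i := 1) (by simp [h, τ])
  simpa [h, τ] using this

theorem trib_tribLen_of_B {m : ℕ} (h : trib m = .B) : trib (tribLen m + 1) = .C := by
  have := trib_tribLen_add (m := m) (i := 1) (by simp [h, τ])
  simpa [h, τ] using this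

theorem tribCount_tribLen (m : ℕ) : tribCount .A (tribLen m) = m ∧
    tribCount .B (tribLen m) = tribCount .A m ∧ tribCount .C (tribLen m) = tribCount .B m := by
  induction m with
  | zero => simp [tribLen]
  | succ m ih =>
    obtain ⟨hA, hB, hC⟩ := ih
    have h0 := trib_tribLen m
    cases hm : trib m
    · have h1 := trib_tribLen_of_A hm
      have hL : tribLen (m + 1) = tribLen m + 1 + 1 := by rw [tribLen_succ, hm]; rfl
      rw [hL]
      simp [Nat.count_succ, hm, h0, h1, hA, hB, hC]
    · have h1 := trib_tribLen_of_B hm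
      have hL : tribLen (m + 1) = tribLen m + 1 + 1 := by rw [tribLen_succ, hm]; rfl
      rw [hL]
      simp [Nat.count_succ, hm, h0, h1, hA, hB, hC]
    · have hL : tribLen (m + 1) = tribLen m + 1 := by rw [tribLen_succ, hm]; rfl
      rw [hL]
      simp [Nat.count_succ, hm, h0, hA, hB, hC]

/-- Position of the `m`-th `b` (both 0-indexed) in the Tribonacci word. -/
def tribPosB (m : ℕ) : ℕ := tribLen (tribLen m) + 1

/-- Position of the `m`-th `c` (both 0-indexed) in the Tribonacci word. -/
def tribPosC (m : ℕ) : ℕ := tribLen (tribPosB m) + 1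

theorem trib_tribPosB (m : ℕ) : trib (tribPosB m) = .B := trib_tribLen_of_A (trib_tribLen m)

theorem trib_tribPosC (m : ℕ) : trib (tribPosC m) = .C := trib_tribLen_of_B (trib_tribPosB m)

theorem tribCount_tribPosB (m : ℕ) :
    tribCount .A (tribPosB m) = tribLen m + 1 ∧ tribCount .B (tribPosB m) = m := by
  simp [tribPosB, Nat.count_succ, trib_tribLen, tribCount_tribLen]

theorem tribCount_tribPosC (m : ℕ) :
    tribCount .A (tribPosC m) = tribPosB m + 1 ∧ tribCount .C (tribPosC m) = m := by
  simp [tribPosC, Nat.count_succ, trib_tribLen, tribCount_tribLen, tribCount_tribPosB]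

theorem infinite_trib_ne {y : ABC} (h : y ≠ .A) : {i | trib i ≠ y}.Infinite := by
  refine Set.infinite_of_injective_forall_mem (f := tribLen) (fun m n hmn => ?_) fun m => ?_
  · rw [← (tribCount_tribLen m).1, hmn, (tribCount_tribLen n).1]
  · simpa [trib_tribLen] using h.symm

theorem count_tribDel {x y : ABC} (h : x ≠ y) (j : ℕ) :
    Nat.count (fun i => tribDel y i = x) (Nat.count (fun i => trib i ≠ y) j) =
      tribCount x j := by
  induction j with
  | zero => simp
  | succ j ih =>
    by_cases hj : trib j = y
    · have : trib j ≠ x := by rw [hj]; exact h.symm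
      simpa [Nat.count_succ, hj, this, h.symm] using ih
    · have hd : tribDel y (Nat.count (fun i => trib i ≠ y) j) = trib j := by
        rw [tribDel, Nat.nth_count (p := fun i => trib i ≠ y) hj]
      rw [Nat.count_succ (fun i => trib i ≠ y), if_pos hj, Nat.count_succ, ih, hd]
      exact (Nat.count_succ (fun i => trib i = x) j).symm

theorem occ_tribDel {y : ABC} {j : ℕ} (h : trib j ≠ y) :
    occ (tribDel y) (trib j) (tribCount (trib j) j + 1) =
      Nat.count (fun i => trib i ≠ y) j + 1 := by
  have hd : tribDel y (Nat.count (fun i => trib i ≠ y) j) = trib j := by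
    rw [tribDel, Nat.nth_count (p := fun i => trib i ≠ y) h]
  rw [occ, Nat.add_sub_cancel, ← count_tribDel h,
    Nat.nth_count (p := fun i => tribDel y i = trib j) hd]

theorem count_trib_ne_B (j : ℕ) :
    Nat.count (fun i => trib i ≠ .B) j = tribCount .A j + tribCount .C j := by
  induction j with
  | zero => simp
  | succ j ih => simp only [tribCount, Nat.count_succ, ih]; cases trib j <;> simp <;> omega

theorem count_trib_ne_C (j : ℕ) :
    Nat.count (fun i => trib i ≠ .C) j = tribCount .A j + tribCount .B j := by
  induction j with
  | zero => simp
  | succ j ih => simp only [tribCount, Nat.count_succ, ih]; cases trib j <;> simp <;> omega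

/-- The sequences `f` and `g` enumerate complementary sets of positive integers. -/
structure Complementary (f g : ℕ → ℕ) : Prop where
  strictMono_left : StrictMono f
  strictMono_right : StrictMono g
  lt : ∀ m, f m < g m
  pos : ∀ m, 0 < f m
  ne : ∀ m n, f m ≠ g n
  cover : ∀ k, 0 < k → (∃ m, f m = k) ∨ ∃ m, g m = k

theorem Complementary.isLeast {f g : ℕ → ℕ} (h : Complementary f g) (n : ℕ) :
    IsLeast {k | 0 < k ∧ (∀ i < n, k ≠ f i) ∧ ∀ i < n, k ≠ g i} (f n) := by
  refine ⟨⟨h.pos n, fun i hi => (h.strictMono_left hi).ne', fun i _ => h.ne n i⟩, ?_⟩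
  rintro k ⟨hk, hf, hg⟩
  rcases h.cover k hk with ⟨m, rfl⟩ | ⟨m, rfl⟩
  · exact h.strictMono_left.monotone (not_lt.1 fun hm => hf m hm rfl)
  · exact (h.lt n).le.trans (h.strictMono_right.monotone (not_lt.1 fun hm => hg m hm rfl))

/-- Enumerating, in the word with `y ≠ a` deleted, the letter `a` and the remaining letter `x`
at positions `p` of the Tribonacci word. -/
theorem complementary_count {x y : ABC} (hy : y ≠ .A) (hxA : x ≠ .A) (hxy : x ≠ y) {p : ℕ → ℕ}
    (hp : ∀ m, trib (p m) = x) (hpc : ∀ m, tribCount x (p m) = m) (hlt : ∀ m, tribLen m < p m) :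
    Complementary (fun m => Nat.count (fun i => trib i ≠ y) (tribLen m) + 1)
      (fun m => Nat.count (fun i => trib i ≠ y) (p m) + 1) := by
  have hA (m : ℕ) : trib (tribLen m) ≠ y := by rw [trib_tribLen]; exact hy.symm
  have hX (m : ℕ) : trib (p m) ≠ y := by rw [hp]; exact hxy
  have strict {i j : ℕ} (hi : trib i ≠ y) (hij : i < j) :
      Nat.count (fun i => trib i ≠ y) i + 1 < Nat.count (fun i => trib i ≠ y) j + 1 :=
    Nat.succ_lt_succ (Nat.count_strict_mono (p := fun i => trib i ≠ y) hi hij)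
  refine ⟨fun m n h => strict (hA m) ?_, fun m n h => strict (hX m) ?_,
    fun m => strict (hA m) (hlt m), fun m => Nat.succ_pos _, fun m n h => ?_, fun k hk => ?_⟩
  · refine Nat.lt_of_count_lt_count (p := fun i => trib i = .A) ?_
    simpa [tribCount_tribLen] using h
  · refine Nat.lt_of_count_lt_count (p := fun i => trib i = x) ?_
    simpa [hpc] using h
  · have := Nat.count_injective (p := fun i => trib i ≠ y) (hA m) (hX n) (Nat.succ_injective h)
    have h' := hp n
    rw [← this, trib_tribLen] at h'
    exact hxA h'.symm
  · obtain ⟨k, rfl⟩ := Nat.exists_eq_succ_of_ne_zero hk.ne'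
    have hinf := infinite_trib_ne hy
    set j := Nat.nth (fun i => trib i ≠ y) k with hj
    have hjy : trib j ≠ y := Nat.nth_mem_of_infinite hinf k
    have hjk : Nat.count (fun i => trib i ≠ y) j = k := Nat.count_nth_of_infinite hinf k
    by_cases hjA : trib j = .A
    · refine .inl ⟨tribCount .A j, ?_⟩
      rw [Nat.count_injective (p := fun i => trib i = .A) (trib_tribLen _) hjA
        (tribCount_tribLen _).1, hjk]
    · have hjx : trib j = x := by
        revert hjA hjy hy hxA hxy
        generalize trib j = z
        cases x <;> cases y <;> cases z <;> simp
      refine .inr ⟨tribCount x j, ?_⟩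
      rw [Nat.count_injective (p := fun i => trib i = x) (hp _) hjx (hpc _), hjk]

theorem le_tribLen (m : ℕ) : m ≤ tribLen m := by simp only [tribLen]; omega

theorem tribLen_lt_tribPosB (m : ℕ) : tribLen m < tribPosB m :=
  Nat.lt_succ_of_le (le_tribLen _)

theorem tribPosB_lt_tribPosC (m : ℕ) : tribPosB m < tribPosC m :=
  Nat.lt_succ_of_le (le_tribLen _)

theorem tribPosB_eq (m : ℕ) :
    tribPosB m = 2 * m + 2 * tribCount .A m + tribCount .B m + 1 := by
  rw [tribPosB, tribLen, (tribCount_tribLen m).1, (tribCount_tribLen m).2.1, tribLen]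
  omega

theorem complementary_delB : Complementary (fun m => m + tribCount .B m + 1)
    (fun m => 3 * m + 2 * tribCount .A m + tribCount .B m + 3) := by
  have h := complementary_count (x := .C) (y := .B) (by simp) (by simp) (by simp)
    trib_tribPosC (fun m => (tribCount_tribPosC m).2)
    fun m => (tribLen_lt_tribPosB m).trans (tribPosB_lt_tribPosC m)
  convert h using 2 with m m
  · rw [count_trib_ne_B, (tribCount_tribLen m).1, (tribCount_tribLen m).2.2]
  · rw [count_trib_ne_B, (tribCount_tribPosC m).1, (tribCount_tribPosC m).2, tribPosB_eq]
    omega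

theorem complementary_delC : Complementary (fun m => m + tribCount .A m + 1)
    (fun m => 2 * m + tribCount .A m + tribCount .B m + 2) := by
  have h := complementary_count (x := .B) (y := .C) (by simp) (by simp) (by simp)
    trib_tribPosB (fun m => (tribCount_tribPosB m).2) tribLen_lt_tribPosB
  convert h using 2 with m m
  · rw [count_trib_ne_C, (tribCount_tribLen m).1, (tribCount_tribLen m).2.1]
  · rw [count_trib_ne_C, (tribCount_tribPosB m).1, (tribCount_tribPosB m).2, tribLen]
    omega

theorem qdee_succ (n : ℕ) : qdee (n + 1) = (n + tribCount .B n + 1,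
    3 * n + 2 * tribCount .A n + tribCount .B n + 3) := by
  induction n using Nat.strong_induction_on with
  | _ n ih =>
  have hA := complementary_delB.isLeast n
  have hD := complementary_delC.isLeast n
  have split (P : ℕ → Prop) : (∀ i ≤ n, P i) ↔ P 0 ∧ ∀ i < n, P (i + 1) := by
    refine ⟨fun h => ⟨h 0 n.zero_le, fun i hi => h _ hi⟩, fun h i hi => ?_⟩
    cases i with
    | zero => exact h.1
    | succ i => exact h.2 i hi
  have hmex : mex ({m | ∃ i, ∃ _ : i ≤ n, m = (qdee i).1} ∪
      {m | ∃ i, ∃ _ : i ≤ n, m = (qdee i).2}) = n + tribCount .B n + 1 := by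
    refine Eq.trans (congrArg sInf (Set.ext fun k => ?_)) hA.csInf_eq
    simp only [Set.mem_ofPred_eq, Set.mem_union, not_or, not_exists]
    rw [split, split, qdee_zero]
    constructor
    · rintro ⟨⟨h0, h1⟩, -, h2⟩
      exact ⟨Nat.pos_of_ne_zero h0, fun i hi => by simpa [ih i hi] using h1 i hi,
        fun i hi => by simpa [ih i hi] using h2 i hi⟩
    · rintro ⟨h0, h1, h2⟩
      exact ⟨⟨h0.ne', fun i hi => by simpa [ih i hi] using h1 i hi⟩, h0.ne',
        fun i hi => by simpa [ih i hi] using h2 i hi⟩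
  have hmex₂ : mex₂ ({m | ∃ i, ∃ _ : i ≤ n, m = (qdee i).2 - (qdee i).1} ∪
      {m | ∃ i, ∃ _ : i ≤ n, m = (qdee i).2 + (qdee i).1}) =
      2 * (n + tribCount .A n + 1) := by
    refine IsLeast.csInf_eq ⟨?_, ?_⟩
    · obtain ⟨h0, h1, h2⟩ := hD.1
      simp only [Set.mem_ofPred_eq, Set.mem_union, not_or, not_exists]
      rw [split, split, qdee_zero]
      refine ⟨by omega, even_two_mul _, ⟨by simp, fun i hi => ?_⟩, by simp, fun i hi => ?_⟩
      · have := h1 i hi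
        rw [ih i hi]
        dsimp only
        omega
      · have := h2 i hi
        rw [ih i hi]
        dsimp only
        omega
    · intro k hk
      simp only [Set.mem_ofPred_eq, Set.mem_union, not_or, not_exists] at hk
      rw [split, split, qdee_zero] at hk
      obtain ⟨h0, hev, ⟨-, h1⟩, -, h2⟩ := hk
      obtain ⟨k, rfl⟩ := hev.two_dvd
      refine Nat.mul_le_mul_left 2 (hD.2 ⟨by omega, fun i hi => ?_, fun i hi => ?_⟩)
      · have := h1 i hi
        rw [ih i hi] at this
        dsimp only at this
        omega
      · have := h2 i hi
        rw [ih i hi] at this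
        dsimp only at this
        omega
  rw [qdee]
  simp only [hmex, hmex₂, Prod.mk.injEq, true_and]
  omega

/-- For every `n ≥ 1`, `aₙ` is the position of the `n`-th occurrence of the letter `a`
in `t_b` (the Tribonacci word with all `b`'s deleted), and `bₙ` is the position of the
`n`-th occurrence of the letter `c` in `t_b`. -/
theorem qdee_coded_by_tribDelB (n : ℕ) (hn : 1 ≤ n) :
    (qdee n).1 = occ (tribDel ABC.B) ABC.A n ∧
    (qdee n).2 = occ (tribDel ABC.B) ABC.C n := by
  obtain ⟨m, rfl⟩ := Nat.exists_eq_add_of_le' hn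
  have hA := occ_tribDel (y := .B) (j := tribLen m) (by simp [trib_tribLen])
  have hC := occ_tribDel (y := .B) (j := tribPosC m) (by simp [trib_tribPosC])
  rw [trib_tribLen, count_trib_ne_B, (tribCount_tribLen m).1, (tribCount_tribLen m).2.2] at hA
  rw [trib_tribPosC, count_trib_ne_B, (tribCount_tribPosC m).1, (tribCount_tribPosC m).2,
    tribPosB_eq] at hC
  rw [qdee_succ, hA, hC]
  refine ⟨rfl, ?_⟩
  dsimp only
  omega
end

section
/- For every n ≥ 1, n = Σ_{j=0}^∞ ⌊(a_n + 2^{2j}) / 2^{2j+1}⌋, where the sum has only finitely many nonzero terms (the term with index j vanishes as soon as 2^{2j} > a_n). Equivalently, n = Σ_{j=0}^∞ [a_n / 2^{2j+1}], where [x] denotes the integer nearest to x, rounded up when the fractional part equals 1/2. -/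
/-- `vile n` : for `n ≥ 1`, the `n`-th positive integer (in increasing order) whose
2-adic valuation is even, i.e. whose binary representation ends in an even number of
zeros: `vile 1 = 1`, `vile 2 = 3`, `vile 3 = 4`, `vile 4 = 5`, `vile 5 = 7`, …
(these are the first coordinates `aₙ` of the nonzero P-positions of Corner the
Queen Bee). -/
noncomputable def vile (n : ℕ) : ℕ :=
  Nat.nth (fun m => 0 < m ∧ Even (padicValNat 2 m)) (n - 1)

theorem two_pow_succ_dvd_add_two_pow_iff {k : ℕ} (hk : k ≠ 0) (i : ℕ) :
    2 ^ (i + 1) ∣ k + 2 ^ i ↔ padicValNat 2 k = i := by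
  have key : padicValNat 2 k = i ↔ 2 ^ i ∣ k ∧ ¬ 2 ^ (i + 1) ∣ k := by
    rw [padicValNat_dvd_iff_le hk, padicValNat_dvd_iff_le hk]
    omega
  rw [key]
  by_cases h : 2 ^ i ∣ k
  · obtain ⟨c, rfl⟩ := h
    have hpos : 0 < 2 ^ i := by positivity
    rw [← Nat.mul_add_one, pow_succ, Nat.mul_dvd_mul_iff_left hpos, Nat.mul_dvd_mul_iff_left hpos]
    simp only [dvd_mul_right, true_and]
    omega
  · simp only [h, false_and, iff_false]
    intro h'
    exact h ((Nat.dvd_add_left dvd_rfl).1 ((pow_dvd_pow 2 i.le_succ).trans h'))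

theorem sum_ite_two_pow_dvd {k N : ℕ} (hk : k ≠ 0) (hN : k < 2 ^ (2 * N)) :
    (∑ j ∈ Finset.range N, if 2 ^ (2 * j + 1) ∣ k + 2 ^ (2 * j) then 1 else 0) =
      if Even (padicValNat 2 k) then 1 else 0 := by
  simp only [two_pow_succ_dvd_add_two_pow_iff hk]
  have hv : padicValNat 2 k < 2 * N :=
    (Nat.pow_lt_pow_iff_right one_lt_two).1
      ((Nat.le_of_dvd (Nat.pos_of_ne_zero hk) pow_padicValNat_dvd).trans_lt hN)
  split_ifs with h
  · obtain ⟨r, hr⟩ := h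
    rw [Finset.sum_eq_single r]
    · rw [if_pos (by omega)]
    · intro j _ hj
      rw [if_neg (by omega)]
    · intro hr'
      exact absurd (Finset.mem_range.2 (by omega)) hr'
  · refine Finset.sum_eq_zero fun j _ => if_neg fun hj => h ?_
    exact hj ▸ even_two_mul j

theorem sum_range_div_eq_count [DecidablePred fun m => 0 < m ∧ Even (padicValNat 2 m)]
    {N : ℕ} (m : ℕ) (hN : m < 2 ^ (2 * N)) :
    ∑ j ∈ Finset.range N, (m + 2 ^ (2 * j)) / 2 ^ (2 * j + 1) =
      Nat.count (fun m => 0 < m ∧ Even (padicValNat 2 m)) (m + 1) := by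
  induction m with
  | zero =>
    simp only [zero_add, Nat.count_succ, Nat.count_zero, lt_irrefl, false_and, if_false]
    exact Finset.sum_eq_zero fun j _ =>
      Nat.div_eq_of_lt (Nat.pow_lt_pow_right one_lt_two (Nat.lt_succ_self _))
  | succ m ih =>
    rw [Nat.count_succ, ← ih (by omega)]
    have h := sum_ite_two_pow_dvd m.succ_ne_zero hN
    simp only [Nat.succ_pos, true_and]
    rw [← h, ← Finset.sum_add_distrib]
    refine Finset.sum_congr rfl fun j _ => ?_
    rw [add_right_comm, Nat.succ_div]

theorem infinite_even_padicValNat_two :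
    {m : ℕ | 0 < m ∧ Even (padicValNat 2 m)}.Infinite := by
  refine Set.infinite_of_injective_forall_mem (f := fun k : ℕ => 2 * k + 1)
    (fun a b h => by simpa using h) fun k => ⟨by positivity, ?_⟩
  rw [padicValNat.eq_zero_of_not_dvd (by omega)]
  exact Even.zero

/-- For every `n ≥ 1`, `n = Σ_{j=0}^∞ ⌊(aₙ + 2^{2j}) / 2^{2j+1}⌋` (natural-number
division is floor division; the sum has only finitely many nonzero terms, the `j`-th
term vanishing as soon as `2^{2j} > aₙ`). -/
theorem index_eq_tsum (n : ℕ) (hn : 1 ≤ n) :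
    n = ∑' j : ℕ, (vile n + 2 ^ (2 * j)) / 2 ^ (2 * j + 1) := by
  classical
  have hlt : ∀ j, vile n ≤ j → vile n < 2 ^ (2 * j) := fun j hj =>
    calc vile n ≤ 2 * j := by omega
      _ < 2 ^ (2 * j) := Nat.lt_two_pow_self
  rw [tsum_eq_sum (s := Finset.range (vile n)), sum_range_div_eq_count _ (hlt _ le_rfl)]
  · rw [vile, Nat.count_nth_succ_of_infinite infinite_even_padicValNat_two]
    omega
  · intro j hj
    have := hlt j (by simpa using hj)
    apply Nat.div_eq_of_lt
    rw [pow_succ]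
    omega
end

section
/- The sequence n ↦ a_{2·a_n} − 3·a_n is unbounded: for every K ∈ ℕ there exists n ≥ 1 with a_{2·a_n} > 3·a_n + K. (Since b_n = 2a_n for the P-positions of Corner the Queen Bee, this says that a_{b_n} − a_n − b_n is unbounded.) -/
/-- The predicate enumerated by `vile`. -/
def IsVile (m : ℕ) : Prop := 0 < m ∧ Even (padicValNat 2 m)

noncomputable instance : DecidablePred IsVile := Classical.decPred _

theorem isVile_of_odd (y : ℕ) : IsVile (2 * y + 1) := by
  refine ⟨by omega, ?_⟩
  rw [padicValNat.eq_zero_of_not_dvd (by omega)]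
  exact Even.zero

theorem isVile_two_mul_iff {y : ℕ} (hy : 0 < y) : IsVile (2 * y) ↔ ¬ IsVile y := by
  have h : padicValNat 2 (2 * y) = padicValNat 2 y + 1 := by
    rw [padicValNat.mul (by norm_num) (by omega), padicValNat.self (by norm_num), add_comm]
  simp [IsVile, h, hy, Nat.even_add_one]

theorem setOf_isVile_infinite : {m | IsVile m}.Infinite := by
  refine Set.infinite_of_injective_forall_mem (f := fun y : ℕ => 2 * y + 1) ?_ isVile_of_odd
  intro a b h
  simpa using h

theorem count_isVile_odd (y : ℕ) :
    Nat.count IsVile (2 * y + 2) = Nat.count IsVile (2 * y + 1) + 1 := by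
  rw [Nat.count_succ, if_pos (isVile_of_odd y)]

theorem count_isVile_even (y : ℕ) :
    Nat.count IsVile (2 * y + 1) + Nat.count IsVile (y + 1) = 2 * y := by
  induction y with
  | zero => simp [Nat.count_succ, IsVile]
  | succ y ih =>
    have h₁ : Nat.count IsVile (2 * (y + 1) + 1) =
        Nat.count IsVile (2 * y + 2) + if IsVile (2 * (y + 1)) then 1 else 0 :=
      Nat.count_succ _ _
    have h₂ := Nat.count_succ IsVile (y + 1)
    have h₃ := count_isVile_odd y
    have h₄ := isVile_two_mul_iff (Nat.succ_pos y)
    by_cases h : IsVile (y + 1) <;> simp_all <;> omega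

/-- Prefixing three further blocks `10` to the binary expansion `10…10 11` of `3 * m` lowers the
count of vile numbers up to `3 * m`, relative to `2 * m`, by one. -/
theorem exists_odd_count_isVile (t : ℕ) :
    ∃ z, Nat.count IsVile (3 * (2 * z + 1) + 1) + t = 2 * (2 * z + 1) := by
  induction t with
  | zero =>
    refine ⟨0, ?_⟩
    have h₀ := count_isVile_even 0
    have h₁ := count_isVile_odd 0
    have h₂ := count_isVile_even 1
    have h₃ := count_isVile_odd 1
    norm_num at *
    omega
  | succ t ih =>
    obtain ⟨z, hz⟩ := ih
    refine ⟨64 * z + 28, ?_⟩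
    obtain ⟨y, hy⟩ : ∃ y, y = 3 * z + 1 := ⟨_, rfl⟩
    have e₀ : 3 * (2 * z + 1) + 1 = 2 * y + 2 := by omega
    have e₁ : 3 * (2 * (64 * z + 28) + 1) + 1 = 2 * (64 * y + 21) + 2 := by omega
    rw [e₀] at hz
    rw [e₁]
    have a₀ := count_isVile_odd y
    have a₁ := count_isVile_even y
    have a₂ := count_isVile_even (2 * y)
    have a₃ := count_isVile_odd (2 * y)
    have a₄ := count_isVile_even (4 * y + 1)
    have a₅ := count_isVile_even (8 * y + 2)
    have a₆ := count_isVile_odd (8 * y + 2)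
    have a₇ := count_isVile_even (16 * y + 5)
    have a₈ := count_isVile_even (32 * y + 10)
    have a₉ := count_isVile_odd (32 * y + 10)
    have b₀ := count_isVile_even (64 * y + 21)
    have b₁ := count_isVile_odd (64 * y + 21)
    ring_nf at *
    omega

/-- The sequence `n ↦ a_{2aₙ} − 3aₙ` is unbounded: for every `K` there is `n ≥ 1` with
`a_{2aₙ} > 3aₙ + K`.  Since `bₙ = 2aₙ`, this says `a_{bₙ} − aₙ − bₙ` is unbounded for
the P-positions of Corner the Queen Bee. -/
theorem vile_diff_unbounded (K : ℕ) :
    ∃ n : ℕ, 1 ≤ n ∧ vile (2 * vile n) > 3 * vile n + K := by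
  obtain ⟨z, hz⟩ := exists_odd_count_isVile (K + 1)
  refine ⟨Nat.count IsVile (2 * z + 1) + 1, by omega, ?_⟩
  have hv : vile (Nat.count IsVile (2 * z + 1) + 1) = 2 * z + 1 :=
    Nat.nth_count (p := IsVile) (isVile_of_odd z)
  rw [hv]
  have hK : Nat.count IsVile (3 * (2 * z + 1) + 1 + K) ≤
      Nat.count IsVile (3 * (2 * z + 1) + 1) + K := by
    rw [Nat.count_add]
    exact Nat.add_le_add_left (Nat.count_le _) _
  have h : 3 * (2 * z + 1) + 1 + K ≤ Nat.nth IsVile (2 * (2 * z + 1) - 1) :=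
    (Nat.count_le_iff_le_nth (p := IsVile) setOf_isVile_infinite).1 (by omega)
  change 3 * (2 * z + 1) + K < Nat.nth IsVile (2 * (2 * z + 1) - 1)
  omega
end

section
/- For every real K there exists n ≥ 1 such that Σ_{j=0}^∞ ‖3·a_n / 2^{2j+1}‖ > K; that is, the sums Σ_{j=0}^∞ ‖3·a_n / 2^{2j+1}‖ (which converge for each fixed n) are unbounded as n ranges over the positive integers. -/
/-- The distance from a real number `x` to the nearest integer (`round` rounds to a
nearest integer, so `|x - round x|` is this distance). -/
noncomputable def distNearestInt (x : ℝ) : ℝ := |x - round x|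

/-- Every positive integer of even 2-adic valuation is a term of `vile`. -/
theorem exists_vile_eq {m : ℕ} (hm : 0 < m) (hv : Even (padicValNat 2 m)) :
    ∃ n : ℕ, 1 ≤ n ∧ vile n = m := by
  classical
  refine ⟨Nat.count (fun m => 0 < m ∧ Even (padicValNat 2 m)) m + 1, by omega, ?_⟩
  unfold vile
  exact Nat.nth_count (p := fun m => 0 < m ∧ Even (padicValNat 2 m)) ⟨hm, hv⟩

theorem distNearestInt_nonneg (x : ℝ) : 0 ≤ distNearestInt x := abs_nonneg _

theorem distNearestInt_le_abs (x : ℝ) : distNearestInt x ≤ |x| := by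
  simpa [distNearestInt] using round_le x 0

theorem le_distNearestInt {x δ : ℝ} (N : ℤ) (h₁ : N + δ ≤ x) (h₂ : x ≤ N + 1 - δ) :
    δ ≤ distNearestInt x := by
  unfold distNearestInt
  rcases le_or_gt (round x) N with h | h
  · have h' : (round x : ℝ) ≤ N := by exact_mod_cast h
    exact le_trans (by linarith) (le_abs_self _)
  · have h' : (N : ℝ) + 1 ≤ round x := by exact_mod_cast h
    exact le_trans (by linarith) (neg_le_abs _)

theorem summable_distNearestInt_div_two_pow (c : ℝ) :
    Summable fun j : ℕ => distNearestInt (c / 2 ^ (2 * j + 1)) := by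
  have hg : Summable fun j : ℕ => |c| / 2 * (1 / 4 : ℝ) ^ j :=
    (summable_geometric_of_lt_one (by norm_num) (by norm_num)).mul_left _
  refine hg.of_nonneg_of_le (fun j => distNearestInt_nonneg _) fun j => ?_
  refine (distNearestInt_le_abs _).trans (le_of_eq ?_)
  rw [abs_div, abs_of_pos (by positivity : (0 : ℝ) < 2 ^ (2 * j + 1)), pow_succ, pow_mul,
    div_pow, one_pow]
  norm_num
  field_simp

theorem fifteen_mul_sum_sixteen_pow (k : ℕ) :
    15 * ∑ i ∈ Finset.range k, 16 ^ i + 1 = 16 ^ k := by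
  induction k with
  | zero => simp
  | succ k ih => rw [Finset.sum_range_succ, pow_succ]; omega

theorem exists_sum_sixteen_pow_eq {i k : ℕ} (h : i < k) :
    ∃ M : ℕ, ∑ l ∈ Finset.range k, 16 ^ l
      = ∑ l ∈ Finset.range i, 16 ^ l + 16 ^ i * (16 * M + 1) := by
  obtain ⟨d, rfl⟩ := Nat.exists_eq_add_of_lt h
  refine ⟨∑ l ∈ Finset.range d, 16 ^ l, ?_⟩
  rw [add_assoc, Finset.sum_range_add]
  simp only [pow_add _ i, ← Finset.mul_sum]
  rw [Finset.sum_range_succ', Finset.mul_sum]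
  simp only [pow_succ', pow_zero]

theorem quarter_le_distNearestInt_sum_sixteen_pow {i k : ℕ} (h : i < k) :
    1 / 4 ≤ distNearestInt
      (3 * ((∑ l ∈ Finset.range k, 16 ^ l : ℕ) : ℝ) / 2 ^ (2 * (2 * i) + 1)) := by
  obtain ⟨M, hM⟩ := exists_sum_sixteen_pow_eq h
  have hS : 15 * ((∑ l ∈ Finset.range i, 16 ^ l : ℕ) : ℝ) + 1 = 16 ^ i := by
    exact_mod_cast fifteen_mul_sum_sixteen_pow i
  rw [hM]
  generalize (∑ l ∈ Finset.range i, 16 ^ l : ℕ) = s at hS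
  have hs : (0 : ℝ) ≤ s := s.cast_nonneg
  have hp : (0 : ℝ) < 16 ^ i := by positivity
  have h2 : (2 : ℝ) ^ (2 * (2 * i) + 1) = 2 * 16 ^ i := by
    rw [pow_succ, ← mul_assoc, pow_mul]; norm_num [mul_comm]
  rw [h2]
  push_cast
  generalize (16 : ℝ) ^ i = p at *
  apply le_distNearestInt (24 * (M : ℤ) + 1)
  · rw [le_div_iff₀ (by positivity)]; push_cast; nlinarith
  · rw [div_le_iff₀ (by positivity)]; push_cast; nlinarith

/-- For every real `K` there is `n ≥ 1` with `Σ_{j=0}^∞ ‖3aₙ / 2^{2j+1}‖ > K`: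
the sums `Σ_{j=0}^∞ ‖3aₙ / 2^{2j+1}‖` are unbounded as `n` ranges over the positive
integers. -/
theorem sum_distNearestInt_unbounded (K : ℝ) :
    ∃ n : ℕ, 1 ≤ n ∧
      K < ∑' j : ℕ, distNearestInt (3 * (vile n : ℝ) / 2 ^ (2 * j + 1)) := by
  obtain ⟨k, hk⟩ := exists_nat_gt (4 * K)
  have hS := fifteen_mul_sum_sixteen_pow (k + 1)
  have hodd : ¬ 2 ∣ ∑ l ∈ Finset.range (k + 1), 16 ^ l := by
    rw [pow_succ] at hS; omega
  obtain ⟨n, hn, hv⟩ := exists_vile_eq (m := ∑ l ∈ Finset.range (k + 1), 16 ^ l)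
    (by omega) (by simp [padicValNat.eq_zero_of_not_dvd hodd])
  refine ⟨n, hn, ?_⟩
  rw [hv]
  have hinj : Function.Injective fun i : ℕ => 2 * i := mul_right_injective₀ two_ne_zero
  calc K < ∑ _i ∈ Finset.range (k + 1), (1 / 4 : ℝ) := by
        rw [Finset.sum_const, Finset.card_range, nsmul_eq_mul]; push_cast; linarith
    _ ≤ ∑ i ∈ Finset.range (k + 1), distNearestInt
          (3 * ((∑ l ∈ Finset.range (k + 1), 16 ^ l : ℕ) : ℝ) / 2 ^ (2 * (2 * i) + 1)) :=
        Finset.sum_le_sum fun i hi =>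
          quarter_le_distNearestInt_sum_sixteen_pow (Finset.mem_range.mp hi)
    _ = ∑ j ∈ (Finset.range (k + 1)).map ⟨fun i => 2 * i, hinj⟩, distNearestInt
          (3 * ((∑ l ∈ Finset.range (k + 1), 16 ^ l : ℕ) : ℝ) / 2 ^ (2 * j + 1)) := by
        rw [Finset.sum_map]; rfl
    _ ≤ _ := (summable_distNearestInt_div_two_pow _).sum_le_tsum _
        fun j _ => distNearestInt_nonneg _
end

section
/- For n ≥ 1 let u_n be the position of the n-th occurrence of a in t_b and v_n the position of the n-th occurrence of c in t_b, and set u₀ = v₀ = 0. Say that a triple (n, x, y) of natural numbers is good if y > x and, for every k < n: x ∉ {u_k, v_k}, y ∉ {u_k, v_k}, |(y − x) − (v_k − u_k)| > 1, and |(y − x) − (v_k + u_k)| > 1 (computed in ℤ). Then for all n ≥ 1: (1) the triple (n, u_n, v_n) is good; (2) if (n, x, y) is good then x ≥ u_n; (3) if (n, u_n, y) is good then y ≥ v_n. -/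
/-- The infinite word `t_b` (0-indexed) obtained from the Tribonacci word by deleting
all occurrences of the letter `b`. -/
noncomputable def tribDelB (n : ℕ) : ABC :=
  trib (Nat.nth (fun i => trib i ≠ ABC.B) n)

/-- `u n` : for `n ≥ 1`, the position (1-indexed) of the `n`-th occurrence of the
letter `a` in `t_b`; and `u 0 = 0`. -/
noncomputable def u : ℕ → ℕ
  | 0 => 0
  | n + 1 => Nat.nth (fun i => tribDelB i = ABC.A) n + 1

/-- `v n` : for `n ≥ 1`, the position (1-indexed) of the `n`-th occurrence of the
letter `c` in `t_b`; and `v 0 = 0`. -/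
noncomputable def v : ℕ → ℕ
  | 0 => 0
  | n + 1 => Nat.nth (fun i => tribDelB i = ABC.C) n + 1

/-- The triple `(n, x, y)` is good if `y > x` and for every `k < n`:
`x ∉ {u k, v k}`, `y ∉ {u k, v k}`, `|(y − x) − (v k − u k)| > 1` and
`|(y − x) − (v k + u k)| > 1` (computed in `ℤ`). -/
def Good (n x y : ℕ) : Prop :=
  y > x ∧ ∀ k < n,
    x ≠ u k ∧ x ≠ v k ∧ y ≠ u k ∧ y ≠ v k ∧
    1 < |((y : ℤ) - x) - ((v k : ℤ) - u k)| ∧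
    1 < |((y : ℤ) - x) - ((v k : ℤ) + u k)|

namespace ABC

/-- The number of letters `a` among the first `n` letters of the Tribonacci word. -/
abbrev countA (n : ℕ) : ℕ := Nat.count (fun i => trib i = ABC.A) n

/-- The number of letters `b` among the first `n` letters of the Tribonacci word. -/
abbrev countB (n : ℕ) : ℕ := Nat.count (fun i => trib i = ABC.B) n

/-- The number of letters `c` among the first `n` letters of the Tribonacci word. -/
abbrev countC (n : ℕ) : ℕ := Nat.count (fun i => trib i = ABC.C) n

/-- The length of the image under `τ` of the first `n` letters of the Tribonacci word. -/
def blockStart (n : ℕ) : ℕ := n + countA n + countB n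

/-- The prefix of length `n` of the Tribonacci word. -/
def tribTake (n : ℕ) : List ABC := (List.range n).map trib

lemma tribIter_succ (n : ℕ) : tribIter (n + 1) = (tribIter n).flatMap τ := by
  simp only [tribIter, Function.iterate_succ_apply']

lemma flatMap_prefix_flatMap {l₁ l₂ : List ABC} (h : l₁ <+: l₂) : l₁.flatMap τ <+: l₂.flatMap τ := by
  obtain ⟨s, rfl⟩ := h
  simp

lemma tribIter_prefix_succ (n : ℕ) : tribIter n <+: tribIter (n + 1) := by
  induction n with
  | zero => exact ⟨[ABC.B], rfl⟩
  | succ n ih =>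
    rw [tribIter_succ n, tribIter_succ (n + 1)]
    exact flatMap_prefix_flatMap ih

lemma tribIter_prefix_of_le {m n : ℕ} (h : m ≤ n) : tribIter m <+: tribIter n := by
  induction n, h using Nat.le_induction with
  | base => exact List.prefix_rfl
  | succ n _ ih => exact ih.trans (tribIter_prefix_succ n)

lemma length_le_length_flatMap (l : List ABC) : l.length ≤ (l.flatMap τ).length := by
  induction l with
  | nil => simp
  | cons x l ih => cases x <;> simp [τ] at ih ⊢ <;> omega

lemma lt_length_tribIter (n : ℕ) : n < (tribIter n).length := by
  induction n with
  | zero => simp [tribIter]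
  | succ n ih =>
    obtain ⟨s, hs⟩ := tribIter_prefix_of_le (Nat.zero_le n)
    have h0 : tribIter 0 = [ABC.A] := rfl
    rw [h0] at hs
    have := length_le_length_flatMap s
    rw [tribIter_succ]
    rw [← hs] at ih ⊢
    simp [τ] at ih this ⊢
    omega

lemma getElem_tribIter {n i : ℕ} (h : i < (tribIter n).length) : (tribIter n)[i] = trib i := by
  have hi : i < (tribIter (i + 1)).length := (Nat.lt_succ_self i).trans (lt_length_tribIter _)
  have ht : trib i = (tribIter (i + 1))[i] := by
    simp [trib, List.getD_eq_getElem?_getD, List.getElem?_eq_getElem hi]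
  rw [ht]
  rcases le_total n (i + 1) with h' | h'
  · exact (tribIter_prefix_of_le h').getElem h
  · exact ((tribIter_prefix_of_le h').getElem hi).symm

lemma length_tribTake (n : ℕ) : (tribTake n).length = n := by simp [tribTake]

lemma tribTake_succ (n : ℕ) : tribTake (n + 1) = tribTake n ++ [trib n] := by
  simp [tribTake, List.range_succ]

lemma eq_tribTake_of_prefix_tribIter {l : List ABC} {n : ℕ} (h : l <+: tribIter n) :
    l = tribTake l.length := by
  apply List.ext_getElem
  · simp [tribTake]
  · intro i h₁ h₂
    rw [h.getElem h₁, getElem_tribIter]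
    simp [tribTake]

lemma tribTake_prefix_tribIter (n : ℕ) : tribTake n <+: tribIter n := by
  have h := eq_tribTake_of_prefix_tribIter ⟨_, List.take_append_drop n (tribIter n)⟩
  rw [List.length_take, min_eq_left (lt_length_tribIter n).le] at h
  rw [← h]
  exact ⟨_, List.take_append_drop _ _⟩

lemma length_flatMap_tribTake (n : ℕ) : ((tribTake n).flatMap τ).length = blockStart n := by
  induction n with
  | zero => simp [tribTake, blockStart]
  | succ n ih =>
    rw [tribTake_succ, List.flatMap_append, List.length_append, ih]
    simp only [blockStart, countA, countB, Nat.count_succ]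
    cases h : trib n <;> simp [τ] <;> omega

/-- The Tribonacci word is fixed by `τ`. -/
lemma flatMap_tribTake (n : ℕ) : (tribTake n).flatMap τ = tribTake (blockStart n) := by
  have h := flatMap_prefix_flatMap (tribTake_prefix_tribIter n)
  rw [← tribIter_succ] at h
  rw [← length_flatMap_tribTake]
  exact eq_tribTake_of_prefix_tribIter h

lemma getElem_τ_trib {n j : ℕ} (h : j < (τ (trib n)).length) :
    (τ (trib n))[j] = trib (blockStart n + j) := by
  have h₁ := flatMap_tribTake (n + 1)
  rw [tribTake_succ, List.flatMap_append, flatMap_tribTake n] at h₁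
  have h₂ := congrArg (fun l => l[blockStart n + j]?) h₁
  have hl := congrArg List.length h₁
  simp [length_tribTake] at hl
  rw [List.getElem?_append_right (by simp [length_tribTake])] at h₂
  have hlt : blockStart n + j < blockStart (n + 1) := by omega
  simpa [length_tribTake, h, tribTake, hlt] using h₂

lemma trib_blockStart (n : ℕ) : trib (blockStart n) = ABC.A := by
  have h : 0 < (τ (trib n)).length := by cases trib n <;> simp [τ]
  have := getElem_τ_trib h
  rw [Nat.add_zero] at this
  rw [← this]
  generalize trib n = l at h
  cases l <;> rfl

lemma trib_blockStart_add_one_of_A {n : ℕ} (h : trib n = ABC.A) :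
    trib (blockStart n + 1) = ABC.B := by
  rw [← getElem_τ_trib (by simp [h, τ])]
  simp [h, τ]

lemma trib_blockStart_add_one_of_B {n : ℕ} (h : trib n = ABC.B) :
    trib (blockStart n + 1) = ABC.C := by
  rw [← getElem_τ_trib (by simp [h, τ])]
  simp [h, τ]

lemma counts_blockStart (n : ℕ) :
    countA (blockStart n) = n ∧ countB (blockStart n) = countA n ∧
      countC (blockStart n) = countB n := by
  induction n with
  | zero => simp [blockStart]
  | succ n ih =>
    obtain ⟨ha, hb, hc⟩ := ih
    have hA := trib_blockStart n
    cases h : trib n with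
    | A =>
      have hs : blockStart (n + 1) = blockStart n + 1 + 1 := by
        simp [blockStart, countA, countB, Nat.count_succ, h]; omega
      have hB := trib_blockStart_add_one_of_A h
      rw [hs]
      simp only [countA, countB, countC] at ha hb hc ⊢
      simp [Nat.count_succ, h, hA, hB, ha, hb, hc]
    | B =>
      have hs : blockStart (n + 1) = blockStart n + 1 + 1 := by
        simp [blockStart, countA, countB, Nat.count_succ, h]; omega
      have hC := trib_blockStart_add_one_of_B h
      rw [hs]
      simp only [countA, countB, countC] at ha hb hc ⊢
      simp [Nat.count_succ, h, hA, hC, ha, hb, hc]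
    | C =>
      have hs : blockStart (n + 1) = blockStart n + 1 := by
        simp [blockStart, countA, countB, Nat.count_succ, h]; omega
      rw [hs]
      simp only [countA, countB, countC] at ha hb hc ⊢
      simp [Nat.count_succ, h, hA, ha, hb, hc]

lemma nth_A (n : ℕ) : Nat.nth (fun i => trib i = ABC.A) n = blockStart n := by
  have := Nat.nth_count (p := fun i => trib i = ABC.A) (trib_blockStart n)
  rwa [show Nat.count _ _ = n from (counts_blockStart n).1] at this

lemma blockStart_countA {n : ℕ} (h : trib n = ABC.A) : blockStart (countA n) = n := by
  rw [← nth_A]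
  exact Nat.nth_count (p := fun i => trib i = ABC.A) h

lemma count_comp_nth {p q : ℕ → Prop} [DecidablePred p] [DecidablePred q]
    [DecidablePred fun i => q (Nat.nth p i)] (hqp : ∀ i, q i → p i) (n : ℕ) :
    Nat.count (fun i => q (Nat.nth p i)) (Nat.count p n) = Nat.count q n := by
  induction n with
  | zero => simp
  | succ n ih =>
    by_cases hp : p n
    · simp [Nat.count_succ, hp, ih, Nat.nth_count hp]
    · have hq : ¬ q n := fun h => hp (hqp n h)
      simp [Nat.count_succ, hp, hq, ih]

lemma nth_comp_nth {p q : ℕ → Prop} [DecidablePred p] [DecidablePred q]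
    (hqp : ∀ i, q i → p i) {x : ℕ} (hx : q x) :
    Nat.nth (fun i => q (Nat.nth p i)) (Nat.count q x) = Nat.count p x := by
  classical
  rw [← count_comp_nth hqp]
  apply Nat.nth_count (p := fun i => q (Nat.nth p i))
  rwa [Nat.nth_count (hqp x hx)]

lemma count_not_B (n : ℕ) :
    Nat.count (fun i => trib i ≠ ABC.B) n = countA n + countC n := by
  induction n with
  | zero => simp
  | succ n ih =>
    simp only [countA, countC] at ih ⊢
    simp only [Nat.count_succ, ih]
    cases h : trib n <;> simp <;> omega

lemma nth_tribDelB {x : ℕ} {l : ABC} (hl : l ≠ ABC.B) (hx : trib x = l) :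
    Nat.nth (fun i => tribDelB i = l) (Nat.count (fun i => trib i = l) x) =
      countA x + countC x := by
  rw [← count_not_B]
  exact nth_comp_nth (p := fun i => trib i ≠ ABC.B) (q := fun i => trib i = l)
    (fun i h => by simpa [h] using hl) hx

lemma tribDelB_countA_add_countC {x : ℕ} (hx : trib x ≠ ABC.B) :
    tribDelB (countA x + countC x) = trib x := by
  rw [← count_not_B, tribDelB, Nat.nth_count (p := fun i => trib i ≠ ABC.B) hx]

lemma u_succ (n : ℕ) : u (n + 1) = n + countB n + 1 := by
  obtain ⟨ha, _, hc⟩ := counts_blockStart n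
  have := nth_tribDelB (by decide) (trib_blockStart n)
  rw [show Nat.count _ _ = n from ha, ha, hc] at this
  rw [u, this]

lemma tribDelB_u (n : ℕ) : tribDelB (u (n + 1) - 1) = ABC.A := by
  obtain ⟨ha, _, hc⟩ := counts_blockStart n
  have h := trib_blockStart n
  have := tribDelB_countA_add_countC (x := blockStart n) (by simp [h])
  rwa [ha, hc, h, ← Nat.add_sub_cancel (n + countB n) 1, ← u_succ] at this

/-- The position of the letter `c` with index `n` in the Tribonacci word, described by letter
counts. -/
lemma exists_trib_eq_C (n : ℕ) : ∃ x, trib x = ABC.C ∧ countC x = n ∧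
    countA x + countC x = 3 * n + 2 * countA n + countB n + 2 := by
  obtain ⟨ha₁, hb₁, hc₁⟩ := counts_blockStart n
  obtain ⟨ha₂, hb₂, hc₂⟩ := counts_blockStart (blockStart n)
  have hA := trib_blockStart (blockStart n)
  have hB := trib_blockStart_add_one_of_A (trib_blockStart n)
  have e₁ : blockStart (blockStart n) = blockStart n + n + countA n := by
    rw [blockStart, ha₁, hb₁]
  have e₂ : blockStart n = n + countA n + countB n := rfl
  have hbj : countB (blockStart (blockStart n) + 1) = n := by
    simp [countB, Nat.count_succ, hA] at *; omega
  obtain ⟨ha₃, _, hc₃⟩ := counts_blockStart (blockStart (blockStart n) + 1)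
  have hA₃ := trib_blockStart (blockStart (blockStart n) + 1)
  refine ⟨_, trib_blockStart_add_one_of_B hB, ?_⟩
  generalize blockStart (blockStart (blockStart n) + 1) = y at *
  have ha : countA (y + 1) = countA y + 1 := by simp [countA, Nat.count_succ, hA₃]
  have hc : countC (y + 1) = countC y := by simp [countC, Nat.count_succ, hA₃]
  omega

lemma v_succ (n : ℕ) : v (n + 1) = 3 * n + 2 * countA n + countB n + 3 := by
  obtain ⟨x, hx, hc, h⟩ := exists_trib_eq_C n
  have := nth_tribDelB (by decide) hx
  rw [show Nat.count _ _ = n from hc, h] at this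
  rw [v, this]

lemma tribDelB_v (n : ℕ) : tribDelB (v (n + 1) - 1) = ABC.C := by
  obtain ⟨x, hx, hc, h⟩ := exists_trib_eq_C n
  have := tribDelB_countA_add_countC (x := x) (by simp [hx])
  rwa [h, hx, ← Nat.add_sub_cancel (_ + 2) 1, ← v_succ] at this

lemma u_ne_v_of_pos_right {m n : ℕ} (hn : 0 < n) : u m ≠ v n := by
  obtain ⟨n, rfl⟩ := Nat.exists_eq_succ_of_ne_zero hn.ne'
  intro h
  cases m with
  | zero => simp [u, v_succ] at h
  | succ m =>
    have := tribDelB_u m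
    rw [h, tribDelB_v] at this
    cases this

lemma u_ne_v_of_pos_left {m n : ℕ} (hn : 0 < n) : u n ≠ v m := by
  rcases Nat.eq_zero_or_pos m with rfl | hm
  · obtain ⟨n, rfl⟩ := Nat.exists_eq_succ_of_ne_zero hn.ne'
    simp [v, u_succ]
  · exact u_ne_v_of_pos_right hm

lemma trib_ne_B_infinite : {i | trib i ≠ ABC.B}.Infinite := by
  refine Set.infinite_of_injective_forall_mem (f := blockStart) (fun m n h => ?_) (fun n => ?_)
  · rw [← (counts_blockStart m).1, h, (counts_blockStart n).1]
  · change trib _ ≠ _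
    simp [trib_blockStart]

lemma tribDelB_ne_B (n : ℕ) : tribDelB n ≠ ABC.B :=
  Nat.nth_mem_of_infinite trib_ne_B_infinite n

/-- Every positive integer is a value of `u` or of `v`. -/
lemma exists_u_or_v {x : ℕ} (hx : 0 < x) : ∃ k, x = u (k + 1) ∨ x = v (k + 1) := by
  obtain ⟨i, rfl⟩ : ∃ i, x = i + 1 := ⟨x - 1, by omega⟩
  classical
  cases h : tribDelB i with
  | A => exact ⟨_, .inl <| by rw [u, Nat.nth_count (p := fun i => tribDelB i = ABC.A) h]⟩
  | B => exact absurd h (tribDelB_ne_B i)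
  | C => exact ⟨_, .inr <| by rw [v, Nat.nth_count (p := fun i => tribDelB i = ABC.C) h]⟩

lemma u_strictMono : StrictMono u := by
  refine strictMono_nat_of_lt_succ fun n => ?_
  cases n with
  | zero => simp [u]
  | succ n =>
    rw [u_succ, u_succ]
    have : countB n ≤ countB (n + 1) := Nat.count_monotone _ n.le_succ
    omega

lemma v_strictMono : StrictMono v := by
  refine strictMono_nat_of_lt_succ fun n => ?_
  cases n with
  | zero => simp [v]
  | succ n =>
    rw [v_succ, v_succ]
    have : countB n ≤ countB (n + 1) := Nat.count_monotone _ n.le_succ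
    have : countA n ≤ countA (n + 1) := Nat.count_monotone _ n.le_succ
    omega

/-- The half differences `(v - u) / 2` and half sums `(v + u) / 2` are disjoint. -/
lemma add_countA_ne_blockStart_add (n m : ℕ) : n + countA n ≠ blockStart m + m + 1 := by
  have ha := (counts_blockStart m).1
  rcases Nat.lt_or_ge (blockStart m) n with h | h
  · have h₁ : countA (blockStart m + 1) = countA (blockStart m) + 1 := by
      simp [countA, Nat.count_succ, trib_blockStart]
    have h₂ : countA (blockStart m + 1) ≤ countA n := Nat.count_monotone _ h
    omega
  · have : countA n ≤ countA (blockStart m) := Nat.count_monotone _ h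
    omega

/-- The half differences `(v - u) / 2` and half sums `(v + u) / 2` cover the positive integers. -/
lemma exists_add_countA_or_blockStart_add (e : ℕ) :
    (∃ n, e = n + countA n) ∨ ∃ m, e = blockStart m + m + 1 := by
  induction e with
  | zero => exact .inl ⟨0, by simp⟩
  | succ e ih =>
    rcases ih with ⟨n, rfl⟩ | ⟨m, rfl⟩
    · by_cases h : trib n = ABC.A
      · exact .inr ⟨countA n, by rw [blockStart_countA h]⟩
      · exact .inl ⟨n + 1, by simp [countA, Nat.count_succ, h]; omega⟩
    · refine .inl ⟨blockStart m + 1, ?_⟩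
      have ha := (counts_blockStart m).1
      have h₁ : countA (blockStart m + 1) = countA (blockStart m) + 1 := by
        simp [countA, Nat.count_succ, trib_blockStart]
      omega

lemma v_sub_u_succ (n : ℕ) : (v (n + 1) : ℤ) - u (n + 1) = 2 * ((n + countA n : ℕ) : ℤ) + 2 := by
  rw [u_succ, v_succ]
  push_cast
  ring

lemma v_add_u_succ (n : ℕ) :
    (v (n + 1) : ℤ) + u (n + 1) = 2 * ((blockStart n + n + 1 : ℕ) : ℤ) + 2 := by
  rw [u_succ, v_succ, blockStart]
  push_cast
  ring

lemma v_sub_u_strictMono : StrictMono fun n => (v n : ℤ) - u n := by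
  refine strictMono_nat_of_lt_succ fun n => ?_
  cases n with
  | zero =>
    have h := v_sub_u_succ 0
    simp only [Nat.zero_add] at h ⊢
    rw [h]
    simp only [u, v]
    omega
  | succ n =>
    have : countA n ≤ countA (n + 1) := Nat.count_monotone _ n.le_succ
    simp only [v_sub_u_succ]
    omega

lemma even_v_sub_u (n : ℕ) : Even ((v n : ℤ) - u n) := by
  cases n with
  | zero => simp [u, v]
  | succ n => rw [v_sub_u_succ]; exact ⟨(n + countA n : ℕ) + 1, by ring⟩

lemma v_sub_u_ne_v_add_u {n : ℕ} (hn : 0 < n) (m : ℕ) :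
    (v n : ℤ) - u n ≠ (v m : ℤ) + u m := by
  obtain ⟨n, rfl⟩ := Nat.exists_eq_succ_of_ne_zero hn.ne'
  cases m with
  | zero => rw [Nat.succ_eq_add_one, v_sub_u_succ]; simp only [u, v]; omega
  | succ m =>
    rw [Nat.succ_eq_add_one, v_sub_u_succ, v_add_u_succ]
    have := add_countA_ne_blockStart_add n m
    omega

/-- Every even natural number is a difference or a sum of some `v k` and `u k`. -/
lemma exists_v_sub_u_or_v_add_u (e : ℕ) :
    ∃ k, (2 * e : ℤ) = (v k : ℤ) - u k ∨ (2 * e : ℤ) = (v k : ℤ) + u k := by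
  cases e with
  | zero => exact ⟨0, by simp [u, v]⟩
  | succ e =>
    rcases exists_add_countA_or_blockStart_add e with ⟨n, h⟩ | ⟨m, h⟩
    · exact ⟨n + 1, .inl (by rw [v_sub_u_succ, ← h]; push_cast; ring)⟩
    · exact ⟨m + 1, .inr (by rw [v_add_u_succ, ← h]; push_cast; ring)⟩

lemma even_v_add_u (n : ℕ) : Even ((v n : ℤ) + u n) := by
  have h : (v n : ℤ) + u n = (v n - u n) + (u n + u n) := by ring
  rw [h]
  exact (even_v_sub_u n).add ⟨_, rfl⟩

lemma one_lt_abs_sub_of_even {a b : ℤ} (ha : Even a) (hb : Even b) (h : a ≠ b) :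
    1 < |a - b| := by
  obtain ⟨c, rfl⟩ := ha
  obtain ⟨d, rfl⟩ := hb
  rw [lt_abs]
  omega

lemma u_lt_v {n : ℕ} (hn : 0 < n) : u n < v n := by
  have h : (v 0 : ℤ) - u 0 < v n - u n := v_sub_u_strictMono hn
  have hu : u 0 = 0 := rfl
  have hv : v 0 = 0 := rfl
  omega

lemma good_u_v {n : ℕ} (hn : 0 < n) : Good n (u n) (v n) := by
  refine ⟨u_lt_v hn, fun k hk => ⟨(u_strictMono hk).ne', u_ne_v_of_pos_left hn,
    (u_ne_v_of_pos_right hn).symm, (v_strictMono hk).ne', ?_, ?_⟩⟩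
  · exact one_lt_abs_sub_of_even (even_v_sub_u n) (even_v_sub_u k) (v_sub_u_strictMono hk).ne'
  · exact one_lt_abs_sub_of_even (even_v_sub_u n) (even_v_add_u k) (v_sub_u_ne_v_add_u hn k)

lemma u_le_of_good {n x y : ℕ} (hn : 0 < n) (h : Good n x y) : u n ≤ x := by
  by_contra! hx
  have hx0 : 0 < x := Nat.pos_of_ne_zero (h.2 0 hn).1
  obtain ⟨k, rfl | rfl⟩ := exists_u_or_v hx0
  · exact (h.2 _ (u_strictMono.lt_iff_lt.1 hx)).1 rfl
  · exact (h.2 _ (u_strictMono.lt_iff_lt.1 ((u_lt_v k.succ_pos).trans hx))).2.1 rfl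

lemma v_le_of_good {n y : ℕ} (h : Good n (u n) y) : v n ≤ y := by
  by_contra! hy
  obtain ⟨hlt, h⟩ := h
  obtain ⟨k, hk⟩ := exists_v_sub_u_or_v_add_u ((y - u n) / 2)
  have hkn : k < n := by
    refine v_sub_u_strictMono.lt_iff_lt.1 (show (v k : ℤ) - u k < v n - u n from ?_)
    omega
  obtain ⟨-, -, -, -, h₁, h₂⟩ := h k hkn
  rw [lt_abs] at h₁ h₂
  omega

end ABC

/-- For all `n ≥ 1`: (1) the triple `(n, u n, v n)` is good; (2) if `(n, x, y)` is good
then `x ≥ u n`; (3) if `(n, u n, y)` is good then `y ≥ v n`. -/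
theorem good_characterizes_uv (n : ℕ) (hn : 1 ≤ n) :
    Good n (u n) (v n) ∧
    (∀ x y : ℕ, Good n x y → u n ≤ x) ∧
    (∀ y : ℕ, Good n (u n) y → v n ≤ y) := by
  exact ⟨ABC.good_u_v hn, fun _ _ => ABC.u_le_of_good hn, fun _ => ABC.v_le_of_good⟩
end
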